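/- arXiv:2106.04207 — 4 statements merged into one kernel-verified Lean document; each statement's English description precedes it below -/
import Mathlib

section
/- Let (Ω, F, P) be a probability space with a filtration (F_t)_{t=0}^N, let p ∈ (0,1], let y_1, …, y_N be random variables such that each y_t is F_t-measurable, takes values in {0,1}, and satisfies E[y_t | F_{t-1}] = p almost surely, and let c_1, …, c_N be random variables such that each c_t is F_{t-1}-measurable and takes values in [0,1]. Then for every δ ∈ (0,1), with probability at least 1 − δ one has ∑_{t=1}^N c_t y_t ≤ 2p ∑_{t=1}^N c_t + log(1/δ). -/
open MeasureTheory

lemma ecc_exp_le (c y : ℝ) (hc : c ∈ Set.Icc (0 : ℝ) 1) (hy : y = 0 ∨ y = 1) :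
    Real.exp (c * y) ≤ 1 + 2 * c * y := by
  obtain ⟨h0, h1⟩ := hc
  rcases hy with rfl | rfl
  · simp
  · have h := Real.abs_exp_sub_one_sub_id_le (x := c) (by rw [abs_of_nonneg h0]; exact h1)
    have h2 := (abs_le.1 h).2
    rw [mul_one]
    nlinarith

lemma ecc_step {Ω : Type*} (m : MeasurableSpace Ω) {m0 : MeasurableSpace Ω}
    (P : Measure Ω) [IsProbabilityMeasure P] (hm : m ≤ m0)
    (p : ℝ) (hp : 0 < p) (K : ℝ) (Z c y : Ω → ℝ)
    (hZm : Measurable[m] Z) (hZ0 : ∀ ω, 0 ≤ Z ω) (hZK : ∀ ω, Z ω ≤ K)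
    (hcm : Measurable[m] c) (hc : ∀ ω, c ω ∈ Set.Icc (0 : ℝ) 1)
    (hym : Measurable y) (hy : ∀ ω, y ω = 0 ∨ y ω = 1)
    (hcond : P[y|m] =ᵐ[P] fun _ => p) :
    ∫ ω, Z ω * Real.exp (c ω * y ω - 2 * p * c ω) ∂P ≤ ∫ ω, Z ω ∂P := by
  have bddint : ∀ (f : Ω → ℝ) (C : ℝ), Measurable f → (∀ ω, 0 ≤ f ω) → (∀ ω, f ω ≤ C) →
      Integrable f P := by
    intro f C hf h0 hC
    refine Integrable.of_bound hf.aestronglyMeasurable C (ae_of_all _ fun ω => ?_)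
    rw [Real.norm_eq_abs, abs_of_nonneg (h0 ω)]
    exact hC ω
  have hexp1 : ∀ ω, Real.exp (-(2 * p * c ω)) ≤ 1 := by
    intro ω
    rw [Real.exp_le_one_iff]
    have := mul_nonneg hp.le (hc ω).1
    linarith
  let A : Ω → ℝ := fun ω => Z ω * Real.exp (-(2 * p * c ω))
  let B : Ω → ℝ := fun ω => A ω * (2 * c ω)
  have hAm : Measurable[m] A :=
    hZm.mul (Real.measurable_exp.comp ((hcm.const_mul (2 * p)).neg))
  have hBm : Measurable[m] B := hAm.mul (hcm.const_mul 2)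
  have hA0 : ∀ ω, 0 ≤ A ω := fun ω => mul_nonneg (hZ0 ω) (Real.exp_pos _).le
  have hAK : ∀ ω, A ω ≤ K := fun ω =>
    (mul_le_of_le_one_right (hZ0 ω) (hexp1 ω)).trans (hZK ω)
  have hB0 : ∀ ω, 0 ≤ B ω := fun ω => mul_nonneg (hA0 ω) (by linarith [(hc ω).1])
  have hBK : ∀ ω, B ω ≤ 2 * K := by
    intro ω
    change A ω * (2 * c ω) ≤ 2 * K
    nlinarith [hA0 ω, hAK ω, (hc ω).1, (hc ω).2]
  have hy0 : ∀ ω, 0 ≤ y ω := fun ω => by rcases hy ω with h | h <;> simp [h]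
  have hy1 : ∀ ω, y ω ≤ 1 := fun ω => by rcases hy ω with h | h <;> simp [h]
  have hAi : Integrable A P := bddint A K (hAm.mono hm le_rfl) hA0 hAK
  have hBi : Integrable B P := bddint B (2 * K) (hBm.mono hm le_rfl) hB0 hBK
  have hyi : Integrable y P := bddint y 1 hym hy0 hy1
  have hBym : Measurable (B * y) := (hBm.mono hm le_rfl).mul hym
  have hByi : Integrable (B * y) P :=
    bddint _ (2 * K) hBym (fun ω => mul_nonneg (hB0 ω) (hy0 ω))
      (fun ω => (mul_le_of_le_one_right (hB0 ω) (hy1 ω)).trans (hBK ω))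
  have hint : ∫ ω, (B * y) ω ∂P = ∫ ω, B ω * p ∂P := by
    rw [← integral_condExp hm]
    refine integral_congr_ae ?_
    have h1 := condExp_mul_of_stronglyMeasurable_left (μ := P) hBm.stronglyMeasurable hByi hyi
    filter_upwards [h1, hcond] with ω h1 h2
    rw [h1, Pi.mul_apply, h2]
  have hle1 : ∀ ω, Z ω * Real.exp (c ω * y ω - 2 * p * c ω) ≤ A ω + (B * y) ω := by
    intro ω
    have e : Z ω * Real.exp (c ω * y ω - 2 * p * c ω) = A ω * Real.exp (c ω * y ω) := by
      change _ = Z ω * Real.exp (-(2 * p * c ω)) * _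
      rw [mul_assoc (Z ω), ← Real.exp_add]
      ring_nf
    rw [e]
    refine (mul_le_mul_of_nonneg_left (ecc_exp_le _ _ (hc ω) (hy ω)) (hA0 ω)).trans (le_of_eq ?_)
    change _ = A ω + A ω * (2 * c ω) * y ω
    ring
  have hle2 : ∀ ω, A ω + B ω * p ≤ Z ω := by
    intro ω
    have h := Real.add_one_le_exp (2 * p * c ω)
    have h2 := mul_le_mul_of_nonneg_left h (hA0 ω)
    have e : A ω * Real.exp (2 * p * c ω) = Z ω := by
      change Z ω * Real.exp (-(2 * p * c ω)) * _ = _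
      rw [mul_assoc (Z ω), ← Real.exp_add]
      simp
    rw [e] at h2
    refine le_trans (le_of_eq ?_) h2
    change A ω + A ω * (2 * c ω) * p = _
    ring
  calc ∫ ω, Z ω * Real.exp (c ω * y ω - 2 * p * c ω) ∂P
      ≤ ∫ ω, (A ω + (B * y) ω) ∂P := by
        refine integral_mono_of_nonneg (ae_of_all _ fun ω => ?_) (hAi.add hByi)
          (ae_of_all _ hle1)
        exact mul_nonneg (hZ0 ω) (Real.exp_pos _).le
    _ = ∫ ω, (A ω + B ω * p) ∂P := by
        rw [integral_add hAi hByi, hint, integral_add hAi (hBi.mul_const p)]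
    _ ≤ ∫ ω, Z ω ∂P :=
        integral_mono (hAi.add (hBi.mul_const p)) (bddint Z K (hZm.mono hm le_rfl) hZ0 hZK) hle2

/-- Bounded-corruption lemma: if `y_t` are `{0,1}`-valued, `F_t`-measurable with
`E[y_t | F_{t-1}] = p` a.s. for `p ∈ (0,1]`, and the `c_t` are `F_{t-1}`-measurable with
values in `[0,1]`, then for every `δ ∈ (0,1)`, with probability at least `1 − δ`,
`∑_{t=1}^N c_t y_t ≤ 2p ∑_{t=1}^N c_t + log(1/δ)`. -/
theorem experienced_corruption_concentration {Ω : Type*} {m0 : MeasurableSpace Ω}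
    (P : Measure Ω) [IsProbabilityMeasure P] (ℱ : Filtration ℕ m0)
    (N : ℕ) (p : ℝ) (hp : p ∈ Set.Ioc (0 : ℝ) 1)
    (y : ℕ → Ω → ℝ)
    (hy_meas : ∀ t, 1 ≤ t → t ≤ N → Measurable[ℱ t] (y t))
    (hy01 : ∀ t, 1 ≤ t → t ≤ N → ∀ ω, y t ω = 0 ∨ y t ω = 1)
    (hy_cond : ∀ t, 1 ≤ t → t ≤ N → P[y t|ℱ (t - 1)] =ᵐ[P] fun _ => p)
    (c : ℕ → Ω → ℝ)
    (hc_meas : ∀ t, 1 ≤ t → t ≤ N → Measurable[ℱ (t - 1)] (c t))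
    (hc01 : ∀ t, 1 ≤ t → t ≤ N → ∀ ω, c t ω ∈ Set.Icc (0 : ℝ) 1)
    (δ : ℝ) (hδ : δ ∈ Set.Ioo (0 : ℝ) 1) :
    ENNReal.ofReal (1 - δ) ≤
      P {ω | ∑ t ∈ Finset.Icc 1 N, c t ω * y t ω ≤
          2 * p * ∑ t ∈ Finset.Icc 1 N, c t ω + Real.log (1 / δ)} := by
  obtain ⟨hp0, hp1⟩ := hp
  obtain ⟨hδ0, hδ1⟩ := hδ
  let S : ℕ → Ω → ℝ := fun n ω => ∑ t ∈ Finset.Icc 1 n, (c t ω * y t ω - 2 * p * c t ω)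
  have hSm : ∀ n, n ≤ N → Measurable[ℱ n] (S n) := by
    intro n hn
    refine Finset.measurable_fun_sum _ fun t ht => ?_
    rw [Finset.mem_Icc] at ht
    have h1 : Measurable[ℱ n] (c t) :=
      (hc_meas t ht.1 (ht.2.trans hn)).mono (ℱ.mono (by omega)) le_rfl
    have h2 : Measurable[ℱ n] (y t) :=
      (hy_meas t ht.1 (ht.2.trans hn)).mono (ℱ.mono ht.2) le_rfl
    exact (h1.mul h2).sub (h1.const_mul _)
  have hSb : ∀ n, n ≤ N → ∀ ω, S n ω ≤ n := by
    intro n hn ω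
    have : S n ω ≤ ∑ t ∈ Finset.Icc 1 n, (1 : ℝ) := by
      refine Finset.sum_le_sum fun t ht => ?_
      rw [Finset.mem_Icc] at ht
      have h := hc01 t ht.1 (ht.2.trans hn) ω
      have h3 := mul_nonneg hp0.le h.1
      rcases hy01 t ht.1 (ht.2.trans hn) ω with h2 | h2 <;> rw [h2] <;> linarith [h.1, h.2]
    simpa using this
  have hE : ∀ n, n ≤ N → ∫ ω, Real.exp (S n ω) ∂P ≤ 1 := by
    intro n
    induction n with
    | zero => intro _; simp [S]
    | succ n ih =>
      intro hn
      have hs : ∀ ω, Real.exp (S (n + 1) ω) = Real.exp (S n ω) *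
          Real.exp (c (n + 1) ω * y (n + 1) ω - 2 * p * c (n + 1) ω) := by
        intro ω
        rw [← Real.exp_add]
        simp only [S]
        rw [Finset.sum_Icc_succ_top (by omega)]
      simp_rw [hs]
      refine le_trans ?_ (ih (by omega))
      exact ecc_step (ℱ n) P (ℱ.le n) p hp0 (Real.exp n) (fun ω => Real.exp (S n ω))
        (c (n + 1)) (y (n + 1)) (Real.measurable_exp.comp (hSm n (by omega)))
        (fun ω => (Real.exp_pos _).le) (fun ω => Real.exp_le_exp.2 (hSb n (by omega) ω))
        (hc_meas (n + 1) (by omega) hn) (hc01 (n + 1) (by omega) hn)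
        ((hy_meas (n + 1) (by omega) hn).mono (ℱ.le _) le_rfl)
        (hy01 (n + 1) (by omega) hn) (hy_cond (n + 1) (by omega) hn)
  have hSN : Measurable (S N) := (hSm N le_rfl).mono (ℱ.le _) le_rfl
  have hset : {ω | ∑ t ∈ Finset.Icc 1 N, c t ω * y t ω ≤
          2 * p * ∑ t ∈ Finset.Icc 1 N, c t ω + Real.log (1 / δ)} =
      {ω | S N ω ≤ Real.log (1 / δ)} := by
    ext ω
    simp only [Set.mem_setOf_eq, S, Finset.sum_sub_distrib, ← Finset.mul_sum]
    rw [sub_le_iff_le_add']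
  rw [hset]
  have hms : MeasurableSet {ω | S N ω ≤ Real.log (1 / δ)} := hSN measurableSet_Iic
  have hi : Integrable (fun ω => Real.exp (S N ω)) P := by
    refine Integrable.of_bound (Real.measurable_exp.comp hSN).aestronglyMeasurable
      (Real.exp N) (ae_of_all _ fun ω => ?_)
    rw [Real.norm_eq_abs, abs_of_nonneg (Real.exp_pos _).le]
    exact Real.exp_le_exp.2 (hSb N le_rfl ω)
  have hmk := mul_meas_ge_le_integral_of_nonneg
    (ae_of_all P fun ω => (Real.exp_pos (S N ω)).le) hi (1 / δ)
  have hmk2 : P.real {ω | 1 / δ ≤ Real.exp (S N ω)} ≤ δ := by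
    have h := hmk.trans (hE N le_rfl)
    rw [one_div, inv_mul_le_iff₀ hδ0, mul_one] at h
    simpa only [one_div] using h
  have hsub : {ω | S N ω ≤ Real.log (1 / δ)}ᶜ ⊆ {ω | 1 / δ ≤ Real.exp (S N ω)} := by
    intro ω hω
    simp only [Set.mem_compl_iff, Set.mem_setOf_eq, not_le] at hω ⊢
    exact ((Real.log_lt_iff_lt_exp (by positivity)).1 hω).le
  have h3 : P.real {ω | S N ω ≤ Real.log (1 / δ)}ᶜ ≤ δ :=
    (measureReal_mono hsub).trans hmk2
  rw [probReal_compl_eq_one_sub hms] at h3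
  refine ENNReal.ofReal_le_of_le_toReal ?_
  change 1 - δ ≤ P.real _
  linarith
end

section
/- Let (Ω, F, P) be a probability space with a filtration (F_t)_{t=0}^N, let p ∈ (0,1] and μ ∈ [0,1]. Let y_1, …, y_N be random variables such that each y_t is F_t-measurable, takes values in {0,1}, and satisfies E[y_t | F_{t-1}] = p almost surely; let r_1, …, r_N be random variables such that each r_t is F_t-measurable, takes values in [0,1], and satisfies E[r_t y_t | F_{t-1}] = μp almost surely; let c_1, …, c_N be random variables such that each c_t is F_{t-1}-measurable with values in [0,1]; and let r̃_1, …, r̃_N be random variables with values in [0,1] such that |r̃_t − r_t| ≤ c_t almost surely for every t. Then for every δ ∈ (0,1), with probability at least 1 − δ, the corrupted estimator μ̂ = (1/(pN)) ∑_{t=1}^N r̃_t y_t satisfies |μ̂ − μ| ≤ √(2·log(4/δ)/(pN)) + 2·log(4/δ)/(3pN) + 2(∑_{t=1}^N c_t)/N + log(4/δ)/(pN). -/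
open MeasureTheory

lemma aux_k (x : ℝ) (hx : 0 ≤ x) : 0 ≤ 2 + x + Real.exp x * (x - 2) := by
  have hd : ∀ x : ℝ, HasDerivAt (fun x : ℝ => 2 + x + Real.exp x * (x - 2))
      (1 + (Real.exp x * (x - 2) + Real.exp x * 1)) x := fun x =>
    ((hasDerivAt_id x).const_add 2).add ((Real.hasDerivAt_exp x).mul ((hasDerivAt_id x).sub_const 2))
  have hm : Monotone (fun x : ℝ => 2 + x + Real.exp x * (x - 2)) := by
    apply monotone_of_deriv_nonneg (fun x => (hd x).differentiableAt)
    intro x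
    rw [(hd x).deriv]
    have h1 := Real.add_one_le_exp (-x)
    have h2 : Real.exp x * Real.exp (-x) = 1 := by rw [← Real.exp_add]; simp
    nlinarith [Real.exp_pos x]
  have := hm hx
  simpa using this

lemma aux_g (x : ℝ) (hx : 0 ≤ x) : (1 - x / 3) * (Real.exp x - 1 - x) ≤ x ^ 2 / 2 := by
  have hd : ∀ x : ℝ, HasDerivAt (fun x : ℝ => x ^ 2 / 2 - (1 - x / 3) * (Real.exp x - 1 - x))
      ((2 + x + Real.exp x * (x - 2)) / 3) x := fun x => by
    have := (((hasDerivAt_id x).pow 2).div_const 2).sub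
      ((((hasDerivAt_id x).div_const 3).const_sub 1).mul
        (((Real.hasDerivAt_exp x).sub_const 1).sub (hasDerivAt_id x)))
    refine HasDerivAt.congr_deriv this ?_
    simp
    ring
  have hm : MonotoneOn (fun x : ℝ => x ^ 2 / 2 - (1 - x / 3) * (Real.exp x - 1 - x))
      (Set.Ici 0) := by
    apply monotoneOn_of_deriv_nonneg (convex_Ici 0)
    · exact fun x _ => (hd x).continuousAt.continuousWithinAt
    · exact fun x _ => (hd x).differentiableAt.differentiableWithinAt
    · intro x hx
      rw [(hd x).deriv]
      have := aux_k x (by simpa using (interior_subset hx))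
      positivity
  have := hm (Set.mem_Ici.2 le_rfl) (Set.mem_Ici.2 hx) hx
  simp at this
  linarith

lemma aux_neg (x : ℝ) (hx : 0 ≤ x) : Real.exp (-x) - 1 + x ≤ x ^ 2 / 2 := by
  have hd : ∀ x : ℝ, HasDerivAt (fun x : ℝ => x ^ 2 / 2 - (Real.exp (-x) - 1 + x))
      (x + Real.exp (-x) - 1) x := fun x => by
    have := (((hasDerivAt_id x).pow 2).div_const 2).sub
        (((hasDerivAt_id x).neg.exp.sub_const 1).add (hasDerivAt_id x))
    refine HasDerivAt.congr_deriv this ?_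
    simp
    ring
  have hm : Monotone (fun x : ℝ => x ^ 2 / 2 - (Real.exp (-x) - 1 + x)) := by
    apply monotone_of_deriv_nonneg (fun x => (hd x).differentiableAt)
    intro x
    rw [(hd x).deriv]
    have h1 := Real.add_one_le_exp (-x)
    show 0 ≤ _
    linarith
  have := hm hx
  simp at this
  linarith

lemma exp_chord (l x : ℝ) (hx : x ∈ Set.Icc (0 : ℝ) 1) :
    Real.exp (l * x) ≤ 1 + (Real.exp l - 1) * x := by
  have := convexOn_exp.2 (Set.mem_univ 0) (Set.mem_univ l) (sub_nonneg.2 hx.2) hx.1 (by ring)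
  simp at this
  rw [mul_comm]
  linarith

lemma integrable_bdd {Ω : Type*} {m0 : MeasurableSpace Ω} (P : Measure Ω)
    [IsProbabilityMeasure P] (f : Ω → ℝ) (hf : Measurable f) (K : ℝ) (h : ∀ ω, |f ω| ≤ K) :
    Integrable f P :=
  Integrable.of_bound hf.aestronglyMeasurable K (Filter.Eventually.of_forall h)

lemma prod_le_one_int {Ω : Type*} {m0 : MeasurableSpace Ω}
    (P : Measure Ω) [IsProbabilityMeasure P] (ℱ : Filtration ℕ m0) (N : ℕ)
    (Z : ℕ → Ω → ℝ) (hZ : ∀ t, 1 ≤ t → t ≤ N → Measurable[ℱ t] (Z t))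
    (K : ℝ) (hK : 1 ≤ K) (h0 : ∀ t, 1 ≤ t → t ≤ N → ∀ ω, 0 ≤ Z t ω)
    (hb : ∀ t, 1 ≤ t → t ≤ N → ∀ ω, Z t ω ≤ K)
    (hc : ∀ t, 1 ≤ t → t ≤ N → P[Z t|ℱ (t - 1)] ≤ᵐ[P] fun _ => 1) :
    ∀ n ≤ N, Measurable[ℱ n] (fun ω => ∏ t ∈ Finset.Icc 1 n, Z t ω) ∧
      (∀ ω, 0 ≤ ∏ t ∈ Finset.Icc 1 n, Z t ω) ∧ (∀ ω, ∏ t ∈ Finset.Icc 1 n, Z t ω ≤ K ^ n) ∧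
      ∫ ω, ∏ t ∈ Finset.Icc 1 n, Z t ω ∂P ≤ 1 := by
  intro n
  induction n with
  | zero => intro _; simp
  | succ n ih =>
    intro hn
    obtain ⟨i1, i2, i3, i4⟩ := ih (by omega)
    have e : ∀ ω, ∏ t ∈ Finset.Icc 1 (n + 1), Z t ω
        = (∏ t ∈ Finset.Icc 1 n, Z t ω) * Z (n + 1) ω := fun ω => by
      rw [Finset.prod_Icc_succ_top (by omega)]
    simp only [e]
    have hz := hZ (n + 1) (by omega) hn
    have z0 := h0 (n + 1) (by omega) hn
    have zb := hb (n + 1) (by omega) hn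
    have zc := hc (n + 1) (by omega) hn
    have b3 : ∀ ω, (∏ t ∈ Finset.Icc 1 n, Z t ω) * Z (n + 1) ω ≤ K ^ (n + 1) := fun ω => by
      rw [pow_succ]; exact mul_le_mul (i3 ω) (zb ω) (z0 ω) (by positivity)
    have m1 : Measurable[ℱ (n + 1)] fun ω => (∏ t ∈ Finset.Icc 1 n, Z t ω) * Z (n + 1) ω :=
      (i1.mono (ℱ.mono (by omega)) le_rfl).mul hz
    refine ⟨m1, fun ω => mul_nonneg (i2 ω) (z0 ω), b3, ?_⟩
    have iZ : Integrable (Z (n + 1)) P := integrable_bdd P _ (hz.mono (ℱ.le _) le_rfl) K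
      (fun ω => by rw [abs_of_nonneg (z0 ω)]; exact zb ω)
    have iP : Integrable (fun ω => ∏ t ∈ Finset.Icc 1 n, Z t ω) P :=
      integrable_bdd P _ (i1.mono (ℱ.le _) le_rfl) (K ^ n)
      (fun ω => by rw [abs_of_nonneg (i2 ω)]; exact i3 ω)
    have iM : Integrable ((fun ω => ∏ t ∈ Finset.Icc 1 n, Z t ω) * Z (n + 1)) P :=
      integrable_bdd P _ (m1.mono (ℱ.le _) le_rfl) (K ^ (n + 1))
      (fun ω => by
        rw [Pi.mul_apply, abs_of_nonneg (mul_nonneg (i2 ω) (z0 ω))]; exact b3 ω)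
    have hpull := condExp_mul_of_stronglyMeasurable_left (μ := P) (m := ℱ n)
      i1.stronglyMeasurable iM iZ
    have : ∫ ω, (∏ t ∈ Finset.Icc 1 n, Z t ω) * Z (n + 1) ω ∂P
        = ∫ ω, (P[(fun ω => ∏ t ∈ Finset.Icc 1 n, Z t ω) * Z (n + 1)|ℱ n]) ω ∂P :=
      (integral_condExp (ℱ.le n)).symm
    rw [this]
    refine le_trans (integral_mono_ae integrable_condExp iP ?_) i4
    filter_upwards [hpull, zc] with ω h1 h2
    rw [h1]
    exact mul_le_of_le_one_right (i2 ω) h2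

lemma tail_bound {Ω : Type*} {m0 : MeasurableSpace Ω}
    (P : Measure Ω) [IsProbabilityMeasure P] (ℱ : Filtration ℕ m0) (N : ℕ)
    (x m : ℕ → Ω → ℝ) (hx : ∀ t, 1 ≤ t → t ≤ N → Measurable[ℱ t] (x t))
    (hm : ∀ t, 1 ≤ t → t ≤ N → Measurable[ℱ (t - 1)] (m t))
    (hx1 : ∀ t, 1 ≤ t → t ≤ N → ∀ ω, x t ω ∈ Set.Icc (0 : ℝ) 1)
    (hm1 : ∀ t, 1 ≤ t → t ≤ N → ∀ ω, m t ω ∈ Set.Icc (0 : ℝ) 1)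
    (hc : ∀ t, 1 ≤ t → t ≤ N → P[x t|ℱ (t - 1)] =ᵐ[P] m t) (l L : ℝ) :
    P.real {ω | L ≤ ∑ t ∈ Finset.Icc 1 N, (l * x t ω - (Real.exp l - 1) * m t ω)}
      ≤ Real.exp (-L) := by
  set K := Real.exp (|l| + |Real.exp l - 1|) with hKdef
  have hK : 1 ≤ K := Real.one_le_exp (by positivity)
  have key := prod_le_one_int P ℱ N
    (fun t ω => Real.exp (l * x t ω - (Real.exp l - 1) * m t ω)) ?_ K hK ?_ ?_ ?_ N le_rfl
  · obtain ⟨k1, k2, k3, k4⟩ := key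
    have mk := mul_meas_ge_le_integral_of_nonneg (μ := P) (Filter.Eventually.of_forall k2)
      (integrable_bdd P _ (k1.mono (ℱ.le _) le_rfl) (K ^ N)
      (fun ω => by rw [abs_of_nonneg (k2 ω)]; exact k3 ω)) (Real.exp L)
    have e : {ω | Real.exp L ≤ ∏ t ∈ Finset.Icc 1 N,
          Real.exp (l * x t ω - (Real.exp l - 1) * m t ω)}
        = {ω | L ≤ ∑ t ∈ Finset.Icc 1 N, (l * x t ω - (Real.exp l - 1) * m t ω)} := by
      ext ω
      simp only [Set.mem_setOf_eq]
      rw [← Real.exp_sum, Real.exp_le_exp]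
    rw [e] at mk
    rw [Real.exp_neg, ← one_div, le_div_iff₀ (Real.exp_pos L), mul_comm]
    exact mk.trans k4
  · intro t h1 h2
    exact Real.measurable_exp.comp (((hx t h1 h2).const_mul l).sub
      (((hm t h1 h2).mono (ℱ.mono (by omega)) le_rfl).const_mul _))
  · intro t _ _ ω; positivity
  · intro t h1 h2 ω
    apply Real.exp_le_exp.2
    have a1 : l * x t ω ≤ |l| := by
      calc _ ≤ |l * x t ω| := le_abs_self _
        _ = |l| * x t ω := by rw [abs_mul, abs_of_nonneg (hx1 t h1 h2 ω).1]
        _ ≤ _ := mul_le_of_le_one_right (abs_nonneg _) (hx1 t h1 h2 ω).2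
    have a2 : -((Real.exp l - 1) * m t ω) ≤ |Real.exp l - 1| := by
      calc _ ≤ |(Real.exp l - 1) * m t ω| := neg_le_abs _
        _ = |Real.exp l - 1| * m t ω := by rw [abs_mul, abs_of_nonneg (hm1 t h1 h2 ω).1]
        _ ≤ _ := mul_le_of_le_one_right (abs_nonneg _) (hm1 t h1 h2 ω).2
    linarith
  · intro t h1 h2
    set g : Ω → ℝ := fun ω => Real.exp (-((Real.exp l - 1) * m t ω)) with hg
    have gm : Measurable[ℱ (t - 1)] g :=
      Real.measurable_exp.comp ((hm t h1 h2).const_mul _).neg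
    have gb : ∀ ω, |g ω| ≤ Real.exp |Real.exp l - 1| := fun ω => by
      rw [abs_of_pos (Real.exp_pos _)]
      apply Real.exp_le_exp.2
      calc _ ≤ |(Real.exp l - 1) * m t ω| := neg_le_abs _
        _ = |Real.exp l - 1| * m t ω := by rw [abs_mul, abs_of_nonneg (hm1 t h1 h2 ω).1]
        _ ≤ _ := mul_le_of_le_one_right (abs_nonneg _) (hm1 t h1 h2 ω).2
    have xm := (hx t h1 h2).mono (ℱ.le _) le_rfl
    have gm' := gm.mono (ℱ.le _) le_rfl
    have ig : Integrable g P := integrable_bdd P g gm' _ gb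
    have ix : Integrable (x t) P := integrable_bdd P _ xm 1 (fun ω => by
      rw [abs_of_nonneg (hx1 t h1 h2 ω).1]; exact (hx1 t h1 h2 ω).2)
    have igx : Integrable (((Real.exp l - 1) • g) * x t) P :=
      (ig.smul (Real.exp l - 1)).mul_bdd (c := 1) xm.aestronglyMeasurable
        (Filter.Eventually.of_forall fun ω => by
          rw [Real.norm_eq_abs, abs_of_nonneg (hx1 t h1 h2 ω).1]; exact (hx1 t h1 h2 ω).2)
    have hle : (fun ω => Real.exp (l * x t ω - (Real.exp l - 1) * m t ω)) ≤
        g + ((Real.exp l - 1) • g) * x t := fun ω => by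
      have := exp_chord l (x t ω) (hx1 t h1 h2 ω)
      simp only [Pi.add_apply, Pi.mul_apply, Pi.smul_apply, smul_eq_mul, hg]
      rw [sub_eq_add_neg, Real.exp_add]
      nlinarith [Real.exp_pos (-((Real.exp l - 1) * m t ω))]
    have ile : Integrable (fun ω => Real.exp (l * x t ω - (Real.exp l - 1) * m t ω)) P := by
      refine (ig.add igx).mono' ?_ (Filter.Eventually.of_forall fun ω => ?_)
      · exact (Real.measurable_exp.comp ((xm.const_mul l).sub
          (((hm t h1 h2).mono (ℱ.le _) le_rfl).const_mul _))).aestronglyMeasurable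
      · rw [Real.norm_eq_abs, abs_of_pos (Real.exp_pos _)]; exact hle ω
    have c1 := condExp_mono (μ := P) (m := ℱ (t - 1)) ile (ig.add igx)
      (Filter.Eventually.of_forall hle)
    have c2 := condExp_add (μ := P) ig igx (ℱ (t - 1))
    have c3 := condExp_of_stronglyMeasurable (μ := P) (ℱ.le (t - 1)) gm.stronglyMeasurable ig
    have c4 := condExp_mul_of_stronglyMeasurable_left (μ := P) (m := ℱ (t - 1))
      (gm.stronglyMeasurable.const_smul (Real.exp l - 1)) igx ix
    filter_upwards [c1, c2, c4, hc t h1 h2] with ω d1 d2 d4 d5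
    refine d1.trans ?_
    rw [d2, Pi.add_apply, c3, d4, Pi.mul_apply, d5]
    simp only [Pi.smul_apply, smul_eq_mul, hg]
    have := Real.add_one_le_exp ((Real.exp l - 1) * m t ω)
    have e1 : Real.exp ((Real.exp l - 1) * m t ω) * Real.exp (-((Real.exp l - 1) * m t ω)) = 1 := by
      rw [← Real.exp_add]; simp
    nlinarith [Real.exp_pos (-((Real.exp l - 1) * m t ω))]

lemma bern (V s L l S μ : ℝ) (hV : 0 < V) (hs : 0 < s) (hL : V * s ^ 2 = 2 * L)
    (hμ : μ ∈ Set.Icc (0 : ℝ) 1) (hl : l = 3 * s / (3 + s))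
    (h1 : l * S - (Real.exp l - 1) * (μ * V) < L)
    (h2 : (-l) * S - (Real.exp (-l) - 1) * (μ * V) < L) :
    |S - μ * V| ≤ V * s + L / 3 := by
  have hl0 : 0 < l := by rw [hl]; positivity
  have g1 := aux_g l hl0.le
  have g2 := aux_neg l hl0.le
  have hls : l * (3 + s) = 3 * s := by rw [hl]; field_simp
  have hl3 : 1 - l / 3 = l / s := by field_simp; nlinarith
  have hlles : l ≤ s := by nlinarith
  have k1 : Real.exp l - 1 - l ≤ l * s / 2 := by
    rw [hl3] at g1
    have : l / s * (Real.exp l - 1 - l) ≤ l / s * (l * s / 2) := by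
      refine g1.trans (le_of_eq ?_); field_simp
    exact le_of_mul_le_mul_left this (by positivity)
  have k2 : Real.exp (-l) - 1 + l ≤ l * s / 2 := by nlinarith
  have kL : L = l * (V * s / 2 + L / 3) := by
    have : L = V * s ^ 2 / 2 := by linarith
    rw [this]
    linear_combination (-(V * s / 6)) * hls
  have hμV : μ * V ≤ V := by nlinarith [hμ.2]
  have hμV0 : 0 ≤ μ * V := mul_nonneg hμ.1 hV.le
  have ls : 0 ≤ l * s / 2 := by positivity
  have q1 : (Real.exp l - 1 - l) * (μ * V) ≤ l * s / 2 * V :=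
    (mul_le_mul_of_nonneg_right k1 hμV0).trans (mul_le_mul_of_nonneg_left hμV ls)
  have q2 : (Real.exp (-l) - 1 + l) * (μ * V) ≤ l * s / 2 * V :=
    (mul_le_mul_of_nonneg_right k2 hμV0).trans (mul_le_mul_of_nonneg_left hμV ls)
  rw [abs_le]
  constructor
  · have : l * (-(S - μ * V)) ≤ l * (V * s + L / 3) := by nlinarith
    linarith [le_of_mul_le_mul_left this hl0]
  · have : l * (S - μ * V) ≤ l * (V * s + L / 3) := by nlinarith
    exact le_of_mul_le_mul_left this hl0

/-- Concentration of the corrupted-reward estimator: `y_t` are the `{0,1}`-valued sampling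
indicators with `E[y_t | F_{t-1}] = p` a.s., `r_t` the stochastic `[0,1]`-valued rewards
with `E[r_t y_t | F_{t-1}] = μp` a.s., `c_t` the `F_{t-1}`-measurable corruptions in
`[0,1]`, and `r̃_t` the `[0,1]`-valued corrupted rewards with `|r̃_t − r_t| ≤ c_t` a.s.
Then for every `δ ∈ (0,1)`, with probability at least `1 − δ`, the corrupted estimator
`μ̂ = (1/(pN)) ∑ r̃_t y_t` satisfies
`|μ̂ − μ| ≤ √(2·log(4/δ)/(pN)) + 2·log(4/δ)/(3pN) + 2(∑ c_t)/N + log(4/δ)/(pN)`. -/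
theorem corrupted_estimator_concentration {Ω : Type*} {m0 : MeasurableSpace Ω}
    (P : Measure Ω) [IsProbabilityMeasure P] (ℱ : Filtration ℕ m0)
    (N : ℕ) (hN : 1 ≤ N) (p : ℝ) (hp : p ∈ Set.Ioc (0 : ℝ) 1)
    (μ : ℝ) (hμ : μ ∈ Set.Icc (0 : ℝ) 1)
    (y : ℕ → Ω → ℝ)
    (hy_meas : ∀ t, 1 ≤ t → t ≤ N → Measurable[ℱ t] (y t))
    (hy01 : ∀ t, 1 ≤ t → t ≤ N → ∀ ω, y t ω = 0 ∨ y t ω = 1)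
    (hy_cond : ∀ t, 1 ≤ t → t ≤ N → P[y t|ℱ (t - 1)] =ᵐ[P] fun _ => p)
    (r : ℕ → Ω → ℝ)
    (hr_meas : ∀ t, 1 ≤ t → t ≤ N → Measurable[ℱ t] (r t))
    (hr01 : ∀ t, 1 ≤ t → t ≤ N → ∀ ω, r t ω ∈ Set.Icc (0 : ℝ) 1)
    (hry_cond : ∀ t, 1 ≤ t → t ≤ N →
      P[fun ω => r t ω * y t ω|ℱ (t - 1)] =ᵐ[P] fun _ => μ * p)
    (c : ℕ → Ω → ℝ)
    (hc_meas : ∀ t, 1 ≤ t → t ≤ N → Measurable[ℱ (t - 1)] (c t))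
    (hc01 : ∀ t, 1 ≤ t → t ≤ N → ∀ ω, c t ω ∈ Set.Icc (0 : ℝ) 1)
    (rtilde : ℕ → Ω → ℝ)
    (hrt01 : ∀ t, 1 ≤ t → t ≤ N → ∀ ω, rtilde t ω ∈ Set.Icc (0 : ℝ) 1)
    (hrt_close : ∀ t, 1 ≤ t → t ≤ N → ∀ᵐ ω ∂P, |rtilde t ω - r t ω| ≤ c t ω)
    (δ : ℝ) (hδ : δ ∈ Set.Ioo (0 : ℝ) 1) :
    ENNReal.ofReal (1 - δ) ≤
      P {ω | |(1 / (p * N)) * (∑ t ∈ Finset.Icc 1 N, rtilde t ω * y t ω) - μ| ≤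
          Real.sqrt (2 * Real.log (4 / δ) / (p * N)) +
            2 * Real.log (4 / δ) / (3 * (p * N)) +
            2 * (∑ t ∈ Finset.Icc 1 N, c t ω) / N +
            Real.log (4 / δ) / (p * N)} := by
  obtain ⟨hp0, hp1⟩ := hp
  obtain ⟨hδ0, hδ1⟩ := hδ
  have hN0 : (0 : ℝ) < N := by exact_mod_cast hN
  set V : ℝ := p * N with hVdef
  have hV : 0 < V := by positivity
  set L : ℝ := Real.log (4 / δ) with hLdef
  have hL : 0 < L := Real.log_pos (by rw [lt_div_iff₀ hδ0]; linarith)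
  have hexp : Real.exp (-L) = δ / 4 := by
    rw [Real.exp_neg, hLdef, Real.exp_log (by positivity), inv_div]
  set s : ℝ := Real.sqrt (2 * L / V) with hsdef
  have hs : 0 < s := Real.sqrt_pos.2 (by positivity)
  have hVs : V * s ^ 2 = 2 * L := by
    rw [hsdef, Real.sq_sqrt (by positivity)]; field_simp
  set l : ℝ := 3 * s / (3 + s) with hl
  have hy1 : ∀ t, 1 ≤ t → t ≤ N → ∀ ω, y t ω ∈ Set.Icc (0 : ℝ) 1 := fun t h1 h2 ω => by
    rcases hy01 t h1 h2 ω with h | h <;> simp [h]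
  have hmul : ∀ a b : ℝ, a ∈ Set.Icc (0 : ℝ) 1 → b ∈ Set.Icc (0 : ℝ) 1 →
      a * b ∈ Set.Icc (0 : ℝ) 1 := fun a b ha hb =>
    ⟨mul_nonneg ha.1 hb.1, mul_le_one₀ ha.2 hb.1 hb.2⟩
  have T := fun l' : ℝ => tail_bound P ℱ N (fun t ω => r t ω * y t ω) (fun _ _ => μ * p)
    (fun t h1 h2 => (hr_meas t h1 h2).mul (hy_meas t h1 h2)) (fun _ _ _ => measurable_const)
    (fun t h1 h2 ω => hmul _ _ (hr01 t h1 h2 ω) (hy1 t h1 h2 ω))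
    (fun t h1 h2 ω => hmul _ _ hμ ⟨hp0.le, hp1⟩) hry_cond l' L
  have T1 := T l
  have T2 := T (-l)
  have T3 := tail_bound P ℱ N (fun t ω => c t ω * y t ω) (fun t ω => c t ω * p)
    (fun t h1 h2 => ((hc_meas t h1 h2).mono (ℱ.mono (by omega)) le_rfl).mul (hy_meas t h1 h2))
    (fun t h1 h2 => (hc_meas t h1 h2).mul_const p)
    (fun t h1 h2 ω => hmul _ _ (hc01 t h1 h2 ω) (hy1 t h1 h2 ω))
    (fun t h1 h2 ω => hmul _ _ (hc01 t h1 h2 ω) ⟨hp0.le, hp1⟩) (fun t h1 h2 => by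
      have iy : Integrable (y t) P := integrable_bdd P _
        ((hy_meas t h1 h2).mono (ℱ.le _) le_rfl) 1 (fun ω => by
        rw [abs_of_nonneg (hy1 t h1 h2 ω).1]; exact (hy1 t h1 h2 ω).2)
      have icy : Integrable (c t * y t) P := integrable_bdd P _
        (((hc_meas t h1 h2).mono (ℱ.le _) le_rfl).mul ((hy_meas t h1 h2).mono (ℱ.le _) le_rfl)) 1
        (fun ω => by
          have := hmul _ _ (hc01 t h1 h2 ω) (hy1 t h1 h2 ω)
          rw [Pi.mul_apply, abs_of_nonneg this.1]; exact this.2)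
      have := condExp_mul_of_stronglyMeasurable_left (μ := P) (m := ℱ (t - 1))
        (hc_meas t h1 h2).stronglyMeasurable icy iy
      filter_upwards [this, hy_cond t h1 h2] with ω e1 e2
      rw [← e2]
      exact e1) 1 L
  rw [hexp] at T1 T2 T3
  set B1 := {ω | L ≤ ∑ t ∈ Finset.Icc 1 N, (l * (r t ω * y t ω) - (Real.exp l - 1) * (μ * p))}
    with hB1
  set B2 := {ω | L ≤ ∑ t ∈ Finset.Icc 1 N,
    ((-l) * (r t ω * y t ω) - (Real.exp (-l) - 1) * (μ * p))} with hB2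
  set B3 := {ω | L ≤ ∑ t ∈ Finset.Icc 1 N,
    (1 * (c t ω * y t ω) - (Real.exp 1 - 1) * (c t ω * p))} with hB3
  have hB : P.real (B1 ∪ B2 ∪ B3) ≤ δ := by
    have u1 := measureReal_union_le (μ := P) (B1 ∪ B2) B3
    have u2 := measureReal_union_le (μ := P) B1 B2
    linarith
  have hBc : ENNReal.ofReal (1 - δ) ≤ P (B1 ∪ B2 ∪ B3)ᶜ := by
    have h1 : (1 : ENNReal) ≤ P (B1 ∪ B2 ∪ B3) + P (B1 ∪ B2 ∪ B3)ᶜ := by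
      rw [← measure_univ (μ := P), ← Set.union_compl_self (B1 ∪ B2 ∪ B3)]
      exact measure_union_le _ _
    have h2 : P (B1 ∪ B2 ∪ B3) ≤ ENNReal.ofReal δ := by
      rw [← ofReal_measureReal]
      exact ENNReal.ofReal_le_ofReal hB
    rw [ENNReal.ofReal_sub _ hδ0.le, ENNReal.ofReal_one]
    exact tsub_le_iff_left.2 (h1.trans (add_le_add_left h2 _))
  refine hBc.trans (measure_mono_ae ?_)
  have hall : ∀ᵐ ω ∂P, ∀ t, 1 ≤ t → t ≤ N → |rtilde t ω - r t ω| ≤ c t ω := by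
    rw [ae_all_iff]; intro t
    by_cases h1 : 1 ≤ t <;> by_cases h2 : t ≤ N <;> simp [h1, h2]
    exact hrt_close t h1 h2
  filter_upwards [hall] with ω hω hmem
  have hmem' : ω ∉ B1 ∪ B2 ∪ B3 := hmem
  simp only [Set.mem_union, not_or, hB1, hB2, hB3, Set.mem_setOf_eq, not_le,
    Finset.sum_sub_distrib, ← Finset.mul_sum, ← Finset.sum_mul, Finset.sum_const, Nat.card_Icc,
    nsmul_eq_mul, Nat.add_sub_cancel, one_mul] at hmem'
  obtain ⟨⟨m1, m2⟩, m3⟩ := hmem'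
  have b := bern V s L l (∑ t ∈ Finset.Icc 1 N, r t ω * y t ω) μ hV hs hVs hμ hl
    (by rw [hVdef]; linarith) (by rw [hVdef]; linarith)
  have hC0 : 0 ≤ ∑ t ∈ Finset.Icc 1 N, c t ω := Finset.sum_nonneg fun t ht => by
    rw [Finset.mem_Icc] at ht; exact (hc01 t ht.1 ht.2 ω).1
  have hcor : |∑ t ∈ Finset.Icc 1 N, rtilde t ω * y t ω - ∑ t ∈ Finset.Icc 1 N, r t ω * y t ω|
      ≤ ∑ t ∈ Finset.Icc 1 N, c t ω * y t ω := by
    rw [← Finset.sum_sub_distrib]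
    refine (Finset.abs_sum_le_sum_abs _ _).trans (Finset.sum_le_sum fun t ht => ?_)
    rw [Finset.mem_Icc] at ht
    rw [← sub_mul, abs_mul, abs_of_nonneg (hy1 t ht.1 ht.2 ω).1]
    exact mul_le_mul_of_nonneg_right (hω t ht.1 ht.2) (hy1 t ht.1 ht.2 ω).1
  have he : Real.exp 1 - 1 ≤ 2 := by linarith [Real.exp_one_lt_d9]
  set C := ∑ t ∈ Finset.Icc 1 N, c t ω
  have m4 : ∑ t ∈ Finset.Icc 1 N, c t ω * y t ω ≤ 2 * (C * p) + L := by
    have := mul_le_mul_of_nonneg_right he (mul_nonneg hC0 hp0.le)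
    linarith
  show |1 / V * _ - μ| ≤ s + 2 * L / (3 * V) + 2 * C / N + L / V
  have f1 : 1 / V * (∑ t ∈ Finset.Icc 1 N, rtilde t ω * y t ω) - μ
      = ((∑ t ∈ Finset.Icc 1 N, rtilde t ω * y t ω) - μ * V) / V := by field_simp
  have f2 : s + 2 * L / (3 * V) + 2 * C / N + L / V
      = (V * s + 2 * L / 3 + 2 * (C * p) + L) / V := by
    rw [hVdef]; field_simp
  rw [f1, f2, abs_div, abs_of_pos hV]
  refine div_le_div_of_nonneg_right ?_ hV.le
  have := abs_sub_le (∑ t ∈ Finset.Icc 1 N, rtilde t ω * y t ω)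
    (∑ t ∈ Finset.Icc 1 N, r t ω * y t ω) (μ * V)
  linarith
end

section
/- Let A be a nonempty finite set of arms, let μ_j ∈ [0,1] for each arm j, let i* be an arm such that μ_{i*} ≥ μ_j for all arms j, let ε > 0, let i ∈ A, and let μ̂_j be reals with |μ̂_j − μ_j| ≤ 2ε for every j ∈ A ∪ {i*}. If max_{j ∈ A}(μ̂_j + 2ε) − μ̂_i > 14ε, then μ_{i*} − μ_i > 8ε. -/
/-- In the stochastic setting, under the concentration event `|μ̂_j − μ_j| ≤ 2ε` for all
`j ∈ A ∪ {i*}`, any active arm `i ∈ A` that triggers the deactivation condition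
`max_{j ∈ A}(μ̂_j + 2ε) − μ̂_i > 14ε` must have gap `μ_{i*} − μ_i > 8ε`. -/
theorem deactivated_arm_large_gap {ι : Type*} (A : Finset ι) (hA : A.Nonempty)
    (μ : ι → ℝ) (hμ : ∀ j, μ j ∈ Set.Icc (0 : ℝ) 1)
    (istar : ι) (hopt : ∀ j, μ j ≤ μ istar)
    (ε : ℝ) (hε : 0 < ε) (i : ι) (hi : i ∈ A) (μhat : ι → ℝ)
    (hconc : ∀ j, (j ∈ A ∨ j = istar) → |μhat j - μ j| ≤ 2 * ε)
    (hdeact : 14 * ε < A.sup' hA (fun j => μhat j + 2 * ε) - μhat i) :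
    8 * ε < μ istar - μ i := by
  have h1 : A.sup' hA (fun j => μhat j + 2 * ε) ≤ μ istar + 4 * ε := by
    apply Finset.sup'_le
    intro j hj
    have h := (abs_le.mp (hconc j (Or.inl hj))).2
    have h2 := hopt j
    show μhat j + 2 * ε ≤ μ istar + 4 * ε
    linarith
  have h3 := (abs_le.mp (hconc i (Or.inl hi))).1
  linarith
end

section
/- Let (Ω, F, P) be a probability space with a filtration (F_t)_{t=0}^T, let V and K be positive natural numbers, let μ : {1,…,K} → [0,1], and let i* ∈ {1,…,K} satisfy μ_{i*} = max_i μ_i. For each round t ∈ {1,…,T}, each agent v ∈ {1,…,V}, and each arm i ∈ {1,…,K}, let r^S_{v,i}(t) and r_{v,i}(t) be [0,1]-valued F_t-measurable random variables with E[r^S_{v,i}(t) | F_{t-1}] = μ_i almost surely, and let i_v(t) : Ω → {1,…,K} be F_{t-1}-measurable. Define the corruption level C = ∑_{t=1}^T ∑_{v=1}^V max_{i} |r_{v,i}(t) − r^S_{v,i}(t)|. Then E[∑_{t=1}^T ∑_{v=1}^V (μ_{i*} − μ_{i_v(t)})] ≤ max_{i ∈ {1,…,K}} E[∑_{t=1}^T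 ∑_{v=1}^V (r_{v,i}(t) − r_{v,i_v(t)}(t))] + 2·E[C]. -/
open MeasureTheory

lemma aux_sel {Ω : Type*} {m0 : MeasurableSpace Ω} (P : Measure Ω)
    {Arm : Type*} [Fintype Arm] [MeasurableSpace Arm] [MeasurableSingletonClass Arm]
    (f : Arm → Ω → ℝ) (hf : ∀ i, Integrable (f i) P) (s : Ω → Arm) (hs : Measurable s) :
    Integrable (fun ω => f (s ω) ω) P ∧
      ∫ ω, f (s ω) ω ∂P = ∑ i, ∫ ω in s ⁻¹' {i}, f i ω ∂P := by
  classical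
  have hm : ∀ i, MeasurableSet (s ⁻¹' {i}) := fun i => hs (measurableSet_singleton i)
  have e : (fun ω => f (s ω) ω) = fun ω => ∑ i, (s ⁻¹' {i}).indicator (f i) ω := by
    funext ω
    rw [Finset.sum_eq_single (s ω)]
    · simp
    · intro b _ hb
      simp [Set.indicator, Ne.symm hb]
    · simp
  have hi : ∀ i, Integrable ((s ⁻¹' {i}).indicator (f i)) P := fun i => (hf i).indicator (hm i)
  rw [e]
  refine ⟨integrable_finsetSum _ fun i _ => hi i, ?_⟩
  rw [integral_finsetSum _ fun i _ => hi i]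
  exact Finset.sum_congr rfl fun i _ => integral_indicator (hm i)

/-- Relation between the stochastic-regime expected pseudo-regret and the
adversarial-regime pseudo-regret in the multi-agent corrupted bandit problem:
`E[R_T] ≤ R̄_T + 2·E[C]`, where `R̄_T = max_i E[∑_t ∑_v (r_{v,i}(t) − r_{v,i_v(t)}(t))]`
and `C = ∑_t ∑_v max_i |r_{v,i}(t) − r^S_{v,i}(t)|` is the corruption level.  Here each
stochastic reward `r^S_{v,i}(t)` is `F_t`-measurable with conditional mean `μ_i` given
`F_{t-1}`, the corrupted rewards `r_{v,i}(t)` are `F_t`-measurable, and each agent's arm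
choice `i_v(t)` is `F_{t-1}`-measurable. -/
theorem expected_regret_le_adversarial_regret_add_corruption
    {Ω : Type*} {m0 : MeasurableSpace Ω} (P : Measure Ω) [IsProbabilityMeasure P]
    (ℱ : Filtration ℕ m0) (T : ℕ)
    {Agent Arm : Type*} [Fintype Agent] [Nonempty Agent]
    [Fintype Arm] [Nonempty Arm] [MeasurableSpace Arm] [MeasurableSingletonClass Arm]
    (μ : Arm → ℝ) (hμ01 : ∀ i, μ i ∈ Set.Icc (0 : ℝ) 1)
    (istar : Arm) (hopt : ∀ i, μ i ≤ μ istar)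
    (rS r : ℕ → Agent → Arm → Ω → ℝ)
    (hrS_meas : ∀ t v i, 1 ≤ t → t ≤ T → Measurable[ℱ t] (rS t v i))
    (hr_meas : ∀ t v i, 1 ≤ t → t ≤ T → Measurable[ℱ t] (r t v i))
    (hrS01 : ∀ t v i ω, rS t v i ω ∈ Set.Icc (0 : ℝ) 1)
    (hr01 : ∀ t v i ω, r t v i ω ∈ Set.Icc (0 : ℝ) 1)
    (hcond : ∀ t v i, 1 ≤ t → t ≤ T → P[rS t v i|ℱ (t - 1)] =ᵐ[P] fun _ => μ i)
    (sel : ℕ → Agent → Ω → Arm)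
    (hsel : ∀ t v, 1 ≤ t → t ≤ T → Measurable[ℱ (t - 1)] (sel t v)) :
    (∫ ω, (∑ t ∈ Finset.Icc 1 T, ∑ v : Agent, (μ istar - μ (sel t v ω))) ∂P) ≤
      (⨆ i : Arm, ∫ ω,
          (∑ t ∈ Finset.Icc 1 T, ∑ v : Agent, (r t v i ω - r t v (sel t v ω) ω)) ∂P) +
        2 * ∫ ω,
          (∑ t ∈ Finset.Icc 1 T, ∑ v : Agent, (⨆ i : Arm, |r t v i ω - rS t v i ω|)) ∂P := by
  have bi : ∀ f : Ω → ℝ, Measurable f → (∀ ω, f ω ∈ Set.Icc (0 : ℝ) 1) → Integrable f P := by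
    intro f hf h
    refine Integrable.of_bound hf.aestronglyMeasurable 1 (Filter.Eventually.of_forall fun ω => ?_)
    rw [Real.norm_eq_abs, abs_of_nonneg (h ω).1]
    exact (h ω).2
  have irS : ∀ t v i, 1 ≤ t → t ≤ T → Integrable (rS t v i) P := fun t v i h1 h2 =>
    bi _ ((hrS_meas t v i h1 h2).mono (ℱ.le t) le_rfl) (hrS01 t v i)
  have ir : ∀ t v i, 1 ≤ t → t ≤ T → Integrable (r t v i) P := fun t v i h1 h2 =>
    bi _ ((hr_meas t v i h1 h2).mono (ℱ.le t) le_rfl) (hr01 t v i)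
  have ms : ∀ t v, 1 ≤ t → t ≤ T → Measurable (sel t v) := fun t v h1 h2 =>
    (hsel t v h1 h2).mono (ℱ.le _) le_rfl
  have iC : ∀ t v, 1 ≤ t → t ≤ T →
      Integrable (fun ω => ⨆ i : Arm, |r t v i ω - rS t v i ω|) P := by
    intro t v h1 h2
    refine bi _ (Measurable.iSup fun i => ?_) fun ω => ⟨?_, ?_⟩
    · have a := (hr_meas t v i h1 h2).mono (ℱ.le t) le_rfl
      have b := (hrS_meas t v i h1 h2).mono (ℱ.le t) le_rfl
      exact (a.sub b).abs
    · exact Real.iSup_nonneg fun i => abs_nonneg _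
    · refine ciSup_le fun i => ?_
      have a := hr01 t v i ω
      have b := hrS01 t v i ω
      rw [abs_le]
      constructor <;> linarith [a.1, a.2, b.1, b.2]
  have hset : ∀ t v i, 1 ≤ t → t ≤ T → ∀ A : Set Ω, MeasurableSet[ℱ (t - 1)] A →
      ∫ ω in A, rS t v i ω ∂P = ∫ ω in A, μ i ∂P := by
    intro t v i h1 h2 A hA
    rw [← setIntegral_condExp (ℱ.le (t - 1)) (irS t v i h1 h2) hA]
    exact integral_congr_ae (ae_restrict_of_ae (hcond t v i h1 h2))
  -- integrability of the three per-round terms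
  have iμ : ∀ t v, 1 ≤ t → t ≤ T → Integrable (fun ω => μ istar - μ (sel t v ω)) P :=
    fun t v h1 h2 => (integrable_const _).sub
      (aux_sel P (fun i _ => μ i) (fun i => integrable_const _) _ (ms t v h1 h2)).1
  have iR : ∀ t v, 1 ≤ t → t ≤ T →
      Integrable (fun ω => r t v istar ω - r t v (sel t v ω) ω) P :=
    fun t v h1 h2 => (ir t v istar h1 h2).sub
      (aux_sel P (r t v) (fun i => ir t v i h1 h2) _ (ms t v h1 h2)).1
  have key : ∀ t v, 1 ≤ t → t ≤ T →
      ∫ ω, (μ istar - μ (sel t v ω)) ∂P ≤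
        ∫ ω, (r t v istar ω - r t v (sel t v ω) ω) ∂P +
          2 * ∫ ω, (⨆ i : Arm, |r t v i ω - rS t v i ω|) ∂P := by
    intro t v h1 h2
    have A := aux_sel P (fun i _ => μ i) (fun i => integrable_const _) _ (ms t v h1 h2)
    have B := aux_sel P (rS t v) (fun i => irS t v i h1 h2) _ (ms t v h1 h2)
    have e1 : ∫ ω, μ (sel t v ω) ∂P = ∫ ω, rS t v (sel t v ω) ω ∂P := by
      rw [A.2, B.2]
      exact Finset.sum_congr rfl fun i _ =>
        (hset t v i h1 h2 _ (hsel t v h1 h2 (measurableSet_singleton i))).symm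
    have e2 : ∫ ω, μ istar ∂P = ∫ ω, rS t v istar ω ∂P := by
      have := hset t v istar h1 h2 Set.univ MeasurableSet.univ
      rw [setIntegral_univ, setIntegral_univ] at this
      exact this.symm
    rw [integral_sub (integrable_const _) A.1, e1, e2, ← integral_sub (irS t v istar h1 h2) B.1,
      ← integral_const_mul, ← integral_add (iR t v h1 h2) ((iC t v h1 h2).const_mul 2)]
    refine integral_mono ((irS t v istar h1 h2).sub B.1)
      ((iR t v h1 h2).add ((iC t v h1 h2).const_mul 2)) fun ω => ?_
    have hb : ∀ j, |r t v j ω - rS t v j ω| ≤ ⨆ i : Arm, |r t v i ω - rS t v i ω| := fun j =>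
      le_ciSup (f := fun i => |r t v i ω - rS t v i ω|) (Set.finite_range _).bddAbove j
    have c1 := abs_le.1 (hb istar)
    have c2 := abs_le.1 (hb (sel t v ω))
    simp only [Pi.sub_apply, Pi.add_apply]
    linarith [c1.1, c2.2]
  have split : ∀ g : ℕ → Agent → Ω → ℝ, (∀ t v, 1 ≤ t → t ≤ T → Integrable (g t v) P) →
      ∫ ω, (∑ t ∈ Finset.Icc 1 T, ∑ v : Agent, g t v ω) ∂P =
        ∑ t ∈ Finset.Icc 1 T, ∑ v : Agent, ∫ ω, g t v ω ∂P := by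
    intro g hg
    have hg' : ∀ t ∈ Finset.Icc 1 T, ∀ v, Integrable (g t v) P := fun t ht v =>
      hg t v (Finset.mem_Icc.1 ht).1 (Finset.mem_Icc.1 ht).2
    rw [integral_finsetSum _ fun t ht => integrable_finsetSum _ fun v _ => hg' t ht v]
    exact Finset.sum_congr rfl fun t ht => integral_finsetSum _ fun v _ => hg' t ht v
  have hsup := le_ciSup (f := fun i : Arm => ∫ ω,
      (∑ t ∈ Finset.Icc 1 T, ∑ v : Agent, (r t v i ω - r t v (sel t v ω) ω)) ∂P)
      (Set.finite_range _).bddAbove istar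
  refine le_trans ?_ (add_le_add_left hsup _)
  rw [split _ iμ, split _ iR, split _ iC, Finset.mul_sum, ← Finset.sum_add_distrib]
  refine Finset.sum_le_sum fun t ht => ?_
  rw [Finset.mul_sum, ← Finset.sum_add_distrib]
  exact Finset.sum_le_sum fun v _ =>
    key t v (Finset.mem_Icc.1 ht).1 (Finset.mem_Icc.1 ht).2
end
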